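/- Let A and B be countable right-orderable groups and G = A ∗ B. Let k ≥ 1 and let w = a₁b₁⋯a_k b_k ∈ G be a reduced word with aᵢ ∈ A∖{1} and bᵢ ∈ B∖{1}. For 1 ≤ i ≤ k set Jᵢ = (2(k−i), 2(k−i)+2) and Iᵢ = (2(k−i)+1, 2(k−i)+3), open intervals in ℝ (so from left to right they appear in the order J_k, I_k, J_{k−1}, I_{k−1}, …, J₁, I₁), and let ε > 0. Then there exist group homomorphisms σ from A to the group of order-preserving bijections of ℝ and τ from B to the group of order-preserving bijections of ℝ (written as right actions) such that: for every α ∈ A, σ(α) maps each Iᵢ onto itself and fixes every point of ℝ outside ⋃ᵢ Iᵢ; for every β ∈ B, τ(β) maps each Jᵢ onto itself and fixes every point of ℝ outside ⋃ᵢ Jᵢ; and the homomorphism ν : G → order-preserving bijections of ℝ induced by σ and τ via the universal property of the free product satisfies 2k·ν(w) ∈ (0, ε), where 2k = sup J₁ and 0 = inf J_k. -/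

import Mathlib

/-- A group is right-orderable if there is a strict total order on it invariant
under right multiplication. -/
def IsRightOrderable (H : Type*) [Group H] : Prop :=
  ∃ lt : H → H → Prop, IsStrictTotalOrder H lt ∧ ∀ f g h : H, lt f g → lt (f * h) (g * h)

/-- A right action of `G` on `ℝ` by orientation-preserving homeomorphisms, i.e. a map
to order-preserving bijections of `ℝ` satisfying `x·σ(gh) = (x·σ(g))·σ(h)`. -/
def IsRightAction {G : Type*} [Group G] (σ : G → (ℝ ≃o ℝ)) : Prop :=
  ∀ g h : G, σ (g * h) = (σ g).trans (σ h)

/-- The list of letters `a₁, b₁, …, a_k, b_k` of the word `w = a₁b₁⋯a_k b_k` in `A ∗ B`. -/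
def wordLetters {A B : Type*} [Group A] [Group B] {k : ℕ}
    (a : Fin k → A) (b : Fin k → B) : List (Monoid.Coprod A B) :=
  (List.finRange k).flatMap fun i => [Monoid.Coprod.inl (a i), Monoid.Coprod.inr (b i)]

/-- The interval `Jᵢ₊₁ = (2(k−(i+1)), 2(k−(i+1))+2)` of the mirrored catenation
`(J_k, I_k, …, J₁, I₁)` (here `i` is the 0-indexed version of the index). -/
noncomputable def mirJ (k i : ℕ) : Set ℝ :=
  Set.Ioo (2 * ((k : ℝ) - ((i : ℝ) + 1))) (2 * ((k : ℝ) - ((i : ℝ) + 1)) + 2)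

/-- The interval `Iᵢ₊₁ = (2(k−(i+1))+1, 2(k−(i+1))+3)` of the mirrored catenation
`(J_k, I_k, …, J₁, I₁)` (here `i` is the 0-indexed version of the index). -/
noncomputable def mirI (k i : ℕ) : Set ℝ :=
  Set.Ioo (2 * ((k : ℝ) - ((i : ℝ) + 1)) + 1) (2 * ((k : ℝ) - ((i : ℝ) + 1)) + 3)

/-- Right-orderability, restated as a right-invariant linear order in which a prescribed
nontrivial element is negative. -/
lemma IsRightOrderable.exists_linearOrder_lt_one {A : Type*} [Group A]
    (hA : IsRightOrderable A) {a : A} (ha : a ≠ 1) :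
    ∃ _ : LinearOrder A, (∀ f g h : A, f < g → f * h < g * h) ∧ a < 1 := by
  classical
  obtain ⟨lt, hlt, hmul⟩ := hA
  rcases (trichotomous_of lt a 1) with h | h | h
  · exact ⟨linearOrderOfSTO lt, hmul, h⟩
  · exact absurd h ha
  · have : IsStrictTotalOrder A (Function.swap lt) := inferInstance
    exact ⟨linearOrderOfSTO (Function.swap lt), fun f g h' hfg => hmul g f h' hfg, h⟩

/-- The extension to `ℝ` of an order automorphism of `ℚ`, by suprema. -/
noncomputable def ratExtend (φ : ℚ ≃o ℚ) (x : ℝ) : ℝ :=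
  sSup ((fun q : ℚ => ((φ q : ℚ) : ℝ)) '' {q : ℚ | (q : ℝ) < x})

lemma ratCast_lt_ratExtend (φ : ℚ ≃o ℚ) (x : ℝ) (r : ℚ) :
    (r : ℝ) < ratExtend φ x ↔ ((φ.symm r : ℚ) : ℝ) < x := by
  obtain ⟨s, hs⟩ := exists_rat_gt x
  have hbdd : BddAbove ((fun q : ℚ => ((φ q : ℚ) : ℝ)) '' {q : ℚ | (q : ℝ) < x}) := by
    refine ⟨(φ s : ℚ), ?_⟩
    rintro _ ⟨q, hq, rfl⟩
    have : q < s := by exact_mod_cast lt_trans hq hs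
    exact Rat.cast_le.2 (φ.strictMono this).le
  constructor
  · intro h
    obtain ⟨s, hs⟩ := exists_rat_lt x
    obtain ⟨_, ⟨q, hq, rfl⟩, hrq⟩ := exists_lt_of_lt_csSup (Set.Nonempty.image _ ⟨s, hs⟩) h
    have : φ.symm r < q := by
      rw [φ.symm_apply_lt]
      exact Rat.cast_lt.1 hrq
    exact lt_trans (by exact_mod_cast this) hq
  · intro h
    obtain ⟨q, h₁, h₂⟩ := exists_rat_btwn h
    have h₁' : φ.symm r < q := by exact_mod_cast h₁
    rw [φ.symm_apply_lt] at h₁'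
    exact lt_of_lt_of_le (Rat.cast_lt.2 h₁') (le_csSup hbdd ⟨q, h₂, rfl⟩)

lemma Real.eq_of_forall_ratCast_lt_iff {x y : ℝ} (h : ∀ r : ℚ, (r : ℝ) < x ↔ (r : ℝ) < y) :
    x = y := by
  apply le_antisymm
  · exact le_of_forall_rat_lt_imp_le fun r hr => ((h r).1 hr).le
  · exact le_of_forall_rat_lt_imp_le fun r hr => ((h r).2 hr).le

lemma ratExtend_mul (φ ψ : ℚ ≃o ℚ) (x : ℝ) :
    ratExtend (φ * ψ) x = ratExtend φ (ratExtend ψ x) := by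
  refine Real.eq_of_forall_ratCast_lt_iff fun r => ?_
  simp only [ratCast_lt_ratExtend]
  rfl

lemma ratExtend_one (x : ℝ) : ratExtend 1 x = x := by
  refine Real.eq_of_forall_ratCast_lt_iff fun r => ?_
  simp only [ratCast_lt_ratExtend]
  rfl

lemma ratExtend_ratCast (φ : ℚ ≃o ℚ) (q : ℚ) : ratExtend φ q = (φ q : ℚ) := by
  refine Real.eq_of_forall_ratCast_lt_iff fun r => ?_
  rw [ratCast_lt_ratExtend]
  norm_cast
  exact φ.symm_apply_lt

lemma ratExtend_monotone (φ : ℚ ≃o ℚ) : Monotone (ratExtend φ) := fun x y hxy =>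
  le_of_forall_rat_lt_imp_le fun r hr => by
    rw [ratCast_lt_ratExtend] at hr
    exact ((ratCast_lt_ratExtend φ y r).2 (hr.trans_le hxy)).le

/-- Extension of order automorphisms of `ℚ` to `ℝ`, as a group homomorphism. -/
noncomputable def ratExtendHom : (ℚ ≃o ℚ) →* (ℝ ≃o ℝ) where
  toFun φ := Equiv.toOrderIso
    { toFun := ratExtend φ
      invFun := ratExtend φ⁻¹
      left_inv := fun x => by rw [← ratExtend_mul, inv_mul_cancel, ratExtend_one]
      right_inv := fun x => by rw [← ratExtend_mul, mul_inv_cancel, ratExtend_one] }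
    (ratExtend_monotone φ) (ratExtend_monotone φ⁻¹)
  map_one' := by ext x; exact ratExtend_one x
  map_mul' φ ψ := by ext x; exact ratExtend_mul φ ψ x

/-- Conjugation by an order isomorphism, as an isomorphism of automorphism groups. -/
def orderAutCongr {X Y : Type*} [LE X] [LE Y] (e : X ≃o Y) : (X ≃o X) →* (Y ≃o Y) where
  toFun f := (e.symm.trans f).trans e
  map_one' := by ext y; exact e.apply_symm_apply y
  map_mul' f g := by
    ext y
    change e (f (g (e.symm y))) = e (f (e.symm (e (g (e.symm y)))))
    rw [e.symm_apply_apply]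

/-- Right multiplication on the first factor of `A ×ₗ ℚ`, for a right-invariant order on `A`. -/
def mulRightLexRat {A : Type*} [Group A] [LinearOrder A]
    (hmul : ∀ f g h : A, f < g → f * h < g * h) : A →* (A ×ₗ ℚ ≃o A ×ₗ ℚ)ᵐᵒᵖ where
  toFun α := MulOpposite.op
    { toFun := fun z => toLex ((ofLex z).1 * α, (ofLex z).2)
      invFun := fun z => toLex ((ofLex z).1 * α⁻¹, (ofLex z).2)
      left_inv := fun z => by simp
      right_inv := fun z => by simp
      map_rel_iff' := by
        intro z w
        have h : (ofLex z).1 * α < (ofLex w).1 * α ↔ (ofLex z).1 < (ofLex w).1 :=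
          ⟨fun h => by simpa using hmul _ _ α⁻¹ h, hmul _ _ α⟩
        simp [Prod.Lex.le_iff, h] }
  map_one' := by
    apply MulOpposite.unop_injective
    ext z
    all_goals simp
  map_mul' α β := by
    apply MulOpposite.unop_injective
    ext z
    all_goals simp [mul_assoc]

/-- A countable right-orderable group acts on `ℝ` with any prescribed nontrivial element
moving some point to the left. -/
lemma IsRightOrderable.exists_action_real {A : Type*} [Group A] [Countable A]
    (hA : IsRightOrderable A) {a : A} (ha : a ≠ 1) :
    ∃ (φ : A →* (ℝ ≃o ℝ)ᵐᵒᵖ) (t : ℝ), (φ a).unop t < t := by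
  obtain ⟨_, hmul, hlt⟩ := hA.exists_linearOrder_lt_one ha
  have : Countable (A ×ₗ ℚ) := inferInstanceAs (Countable (A × ℚ))
  have : Nonempty (A ×ₗ ℚ) := inferInstanceAs (Nonempty (A × ℚ))
  obtain ⟨e⟩ := Order.iso_of_countable_dense (A ×ₗ ℚ) ℚ
  refine ⟨(ratExtendHom.comp (orderAutCongr e)).op.comp (mulRightLexRat hmul),
    (e (toLex (1, 0)) : ℚ), ?_⟩
  change ratExtend (orderAutCongr e (mulRightLexRat hmul a).unop) _ < _
  rw [ratExtend_ratCast]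
  norm_cast
  change e ((mulRightLexRat hmul a).unop (e.symm (e _))) < _
  rw [e.symm_apply_apply, e.lt_iff_lt]
  change toLex (1 * a, (0 : ℚ)) < toLex (1, 0)
  rw [one_mul]
  exact Prod.Lex.left _ _ hlt

/-- On a line, a countable right-orderable group can act so that a prescribed nontrivial
element sends `x` to a prescribed point `y < x`. -/
lemma IsRightOrderable.exists_action_apply_eq {A : Type*} [Group A] [Countable A]
    (hA : IsRightOrderable A) {a : A} (ha : a ≠ 1) {X : Type*} [Preorder X] (c : X ≃o ℝ)
    {x y : X} (hyx : y < x) :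
    ∃ φ : A →* (X ≃o X)ᵐᵒᵖ, (φ a).unop x = y := by
  obtain ⟨φ, t, ht⟩ := hA.exists_action_real ha
  set s := (φ a).unop t with hs
  have hc : c y < c x := c.strictMono hyx
  have hr : 0 < (c x - c y) / (t - s) := div_pos (sub_pos.2 hc) (sub_pos.2 ht)
  have hts : t - s ≠ 0 := (sub_pos.2 ht).ne'
  let e : ℝ ≃o X := (((OrderIso.addRight (-t)).trans (OrderIso.mulRight₀ _ hr)).trans
    (OrderIso.addRight (c x))).trans c.symm
  have het : e t = x := by
    simp [e]
  have hes : e s = y := by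
    simp only [e, OrderIso.trans_apply, OrderIso.addRight_apply, OrderIso.mulRight₀_apply]
    rw [c.symm_apply_eq]
    field_simp
    ring
  refine ⟨(orderAutCongr e).op.comp φ, ?_⟩
  change e ((φ a).unop (e.symm x)) = y
  rw [e.symm_apply_eq.2 het.symm, ← hs, hes]

/-- Automorphisms of the fibres of a monotone map glue to an automorphism of the total space. -/
def glueFibres {X ι : Type*} [LinearOrder X] [LinearOrder ι] {n : X → ι} (hn : Monotone n) :
    (∀ i, {x // n x = i} ≃o {x // n x = i}) →* (X ≃o X) :=
  have key : ∀ (g : ∀ i, {x // n x = i} ≃o {x // n x = i}) (i : ι) (z : {x // n x = i}),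
      (g (n z.1) ⟨z.1, rfl⟩).1 = (g i z).1 := by
    rintro g _ ⟨z, rfl⟩
    rfl
  have hmono : ∀ g : ∀ i, {x // n x = i} ≃o {x // n x = i},
      Monotone fun x => (g (n x) ⟨x, rfl⟩).1 := by
    intro g x y hxy
    rcases (hn hxy).lt_or_eq with h | h
    · refine (hn.reflect_lt ?_).le
      rw [(g (n x) ⟨x, rfl⟩).2, (g (n y) ⟨y, rfl⟩).2]
      exact h
    · have hx := key g (n y) ⟨x, h⟩
      dsimp only at hx ⊢
      rw [hx]
      exact (g (n y)).monotone hxy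
  { toFun := fun g => Equiv.toOrderIso
      { toFun := fun x => (g (n x) ⟨x, rfl⟩).1
        invFun := fun x => ((g⁻¹) (n x) ⟨x, rfl⟩).1
        left_inv := fun x => by
          dsimp only
          rw [key g⁻¹ (n x) (g (n x) ⟨x, rfl⟩)]
          exact congrArg Subtype.val ((g (n x)).symm_apply_apply ⟨x, rfl⟩)
        right_inv := fun x => by
          dsimp only
          rw [key g (n x) ((g⁻¹) (n x) ⟨x, rfl⟩)]
          exact congrArg Subtype.val ((g (n x)).apply_symm_apply ⟨x, rfl⟩) }
      (hmono g) (hmono g⁻¹)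
    map_one' := by ext x; rfl
    map_mul' := fun g h => by
      ext x
      exact (key g (n x) (h (n x) ⟨x, rfl⟩)).symm }

lemma glueFibres_apply {X ι : Type*} [LinearOrder X] [LinearOrder ι] {n : X → ι}
    (hn : Monotone n) (g : ∀ i, {x // n x = i} ≃o {x // n x = i}) (x : X) :
    glueFibres hn g x = (g (n x) ⟨x, rfl⟩).1 := rfl

/-- Given finitely many fibres of a monotone map which are lines, a countable right-orderable
group acts fibrewise, trivially off these fibres, with prescribed moves to the left. -/
lemma IsRightOrderable.exists_fibrewise_action {A : Type*} [Group A] [Countable A]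
    (hA : IsRightOrderable A) {X ι κ : Type*} [LinearOrder X] [LinearOrder ι] {n : X → ι}
    (hn : Monotone n) {d : κ → ι} (hd : Function.Injective d)
    (c : ∀ i, {x // n x = d i} ≃o ℝ) {a : κ → A} (ha : ∀ i, a i ≠ 1) {x y : κ → X}
    (hx : ∀ i, n (x i) = d i) (hy : ∀ i, n (y i) = d i) (hyx : ∀ i, y i < x i) :
    ∃ φ : A →* (X ≃o X)ᵐᵒᵖ,
      (∀ α z, n ((φ α).unop z) = n z) ∧
      (∀ α z, (∀ i, n z ≠ d i) → (φ α).unop z = z) ∧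
      ∀ i, (φ (a i)).unop (x i) = y i := by
  have hfib : ∀ j : ι, ∃ ψ : A →* ({x // n x = j} ≃o {x // n x = j})ᵐᵒᵖ,
      (∀ i (h : n (x i) = j), ((ψ (a i)).unop ⟨x i, h⟩).1 = y i) ∧
      ((∀ i, j ≠ d i) → ψ = 1) := by
    intro j
    by_cases hj : ∃ i, d i = j
    · obtain ⟨i, rfl⟩ := hj
      obtain ⟨ψ, hψ⟩ := hA.exists_action_apply_eq (ha i) (c i)
        (x := ⟨x i, hx i⟩) (y := ⟨y i, hy i⟩) (hyx i)
      refine ⟨ψ, fun i' h => ?_, fun h => absurd rfl (h i)⟩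
      obtain rfl : i' = i := hd ((hx i').symm.trans h)
      rw [hψ]
    · refine ⟨1, fun i h => absurd ⟨i, (hx i).symm.trans h⟩ hj, fun _ => rfl⟩
  choose ψ hψ hψ_one using hfib
  let Ψ : A →* (∀ j, {x // n x = j} ≃o {x // n x = j})ᵐᵒᵖ :=
    { toFun := fun α => MulOpposite.op fun j => (ψ j α).unop
      map_one' := by
        apply MulOpposite.unop_injective
        funext j
        simp
      map_mul' := fun α β => by
        apply MulOpposite.unop_injective
        funext j
        simp }
  refine ⟨(glueFibres hn).op.comp Ψ, fun α z => ((ψ (n z) α).unop ⟨z, rfl⟩).2,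
    fun α z hz => ?_, fun i => hψ _ i rfl⟩
  change ((ψ (n z) α).unop ⟨z, rfl⟩).1 = z
  rw [hψ_one _ hz]
  rfl

/-- An open interval of length `2` is a line. -/
noncomputable def orderIsoIooRadiusOne (S : Set ℝ) (c : ℝ) (hS : S = Set.Ioo (c - 1) (c + 1)) :
    S ≃o ℝ :=
  OrderIso.trans
    { toFun := fun x => (⟨x.1 - c, by
        have hx := hS.subset x.2
        constructor <;> linarith [hx.1, hx.2]⟩ : Set.Ioo (-1 : ℝ) 1)
      invFun := fun x => ⟨x.1 + c, by
        rw [hS]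
        constructor <;> linarith [x.2.1, x.2.2]⟩
      left_inv := fun x => by simp
      right_inv := fun x => by simp
      map_rel_iff' := by
        intro x y
        exact sub_le_sub_iff_right c }
    (orderIsoIooNegOneOne ℝ).symm

/-- The index of `u` in the partition of `ℝ` into integer points `m` (index `2m`) and open unit
intervals `(m, m + 1)` (index `2m + 1`). -/
noncomputable def cellIndex (u : ℝ) : ℤ := ⌊u⌋ + ⌈u⌉

lemma cellIndex_mono : Monotone cellIndex := fun _ _ h =>
  add_le_add (Int.floor_le_floor h) (Int.ceil_le_ceil h)

lemma cellIndex_eq_odd_iff {u : ℝ} {m : ℤ} :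
    cellIndex u = 2 * m + 1 ↔ u ∈ Set.Ioo (m : ℝ) (m + 1) := by
  unfold cellIndex
  have h₁ := Int.floor_le_ceil u
  have h₂ := Int.ceil_le_floor_add_one u
  constructor
  · intro h
    obtain hf : ⌊u⌋ = m := by omega
    have hc : ⌈u⌉ = m + 1 := by omega
    rw [Int.floor_eq_iff] at hf
    rw [Int.ceil_eq_iff] at hc
    push_cast at hc
    exact ⟨by linarith [hc.1], hf.2⟩
  · rintro ⟨h, h'⟩
    have hf : ⌊u⌋ = m := Int.floor_eq_iff.2 ⟨h.le, h'⟩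
    have hc : ⌈u⌉ = m + 1 := Int.ceil_eq_iff.2 ⟨by push_cast; linarith, by push_cast; exact h'.le⟩
    omega

/-- A countable right-orderable group acts on `ℝ` preserving each of the disjoint intervals
`(2 m i + s, 2 m i + s + 2)`, with trivial action off them and prescribed moves to the left. -/
lemma IsRightOrderable.exists_interval_action {A : Type*} [Group A] [Countable A]
    (hA : IsRightOrderable A) {κ : Type*} (s : ℝ) {m : κ → ℤ} (hm : Function.Injective m)
    {I : κ → Set ℝ} (hI : ∀ i, I i = Set.Ioo (2 * (m i : ℝ) + s) (2 * (m i : ℝ) + s + 2))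
    {a : κ → A} (ha : ∀ i, a i ≠ 1) {x y : κ → ℝ}
    (hx : ∀ i, x i ∈ I i) (hy : ∀ i, y i ∈ I i) (hyx : ∀ i, y i < x i) :
    ∃ φ : A →* (ℝ ≃o ℝ)ᵐᵒᵖ,
      (∀ α i, ⇑(φ α).unop '' I i = I i) ∧
      (∀ α z, z ∉ ⋃ i, I i → (φ α).unop z = z) ∧
      ∀ i, (φ (a i)).unop (x i) = y i := by
  let n : ℝ → ℤ := fun z => cellIndex ((z - s) / 2)
  have hn : Monotone n := fun z w h => cellIndex_mono (by linarith)
  have hnI : ∀ i z, n z = 2 * m i + 1 ↔ z ∈ I i := by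
    intro i z
    rw [hI, cellIndex_eq_odd_iff]
    constructor <;> rintro ⟨h, h'⟩ <;> constructor <;> linarith
  obtain ⟨φ, hφn, hφ, hφa⟩ := hA.exists_fibrewise_action hn (d := fun i => 2 * m i + 1)
    (fun i j h => hm (by dsimp only at h; omega))
    (fun i => orderIsoIooRadiusOne {z | n z = 2 * m i + 1} (2 * m i + s + 1) (by
      ext z
      rw [Set.mem_ofPred_eq, hnI, hI]
      constructor <;> rintro ⟨h, h'⟩ <;> constructor <;> linarith))
    ha (fun i => (hnI i _).2 (hx i)) (fun i => (hnI i _).2 (hy i)) hyx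
  refine ⟨φ, fun α i => ?_, fun α z hz => hφ α z fun i h => hz ?_, hφa⟩
  · ext z
    constructor
    · rintro ⟨w, hw, rfl⟩
      rwa [← hnI, hφn, hnI]
    · intro hz
      refine ⟨(φ α).unop.symm z, ?_, OrderIso.apply_symm_apply _ z⟩
      rw [← hnI, ← hφn α, OrderIso.apply_symm_apply]
      exact (hnI i z).2 hz
  · exact Set.mem_iUnion.2 ⟨i, (hnI i z).1 h⟩

/-- A right action following a sequence of points, one for each pair of letters. -/
lemma wordLetters_prod_apply {A B : Type*} [Group A] [Group B] {k : ℕ}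
    (a : Fin k → A) (b : Fin k → B) (ν : Monoid.Coprod A B →* (ℝ ≃o ℝ)ᵐᵒᵖ) (p : ℕ → ℝ)
    (h : ∀ i : Fin k, (ν (.inr (b i))).unop ((ν (.inl (a i))).unop (p i)) = p (i + 1)) :
    (ν (wordLetters a b).prod).unop (p 0) = p k := by
  have key : ∀ m ≤ k, (ν (((List.finRange k).take m).flatMap fun i =>
      [Monoid.Coprod.inl (a i), Monoid.Coprod.inr (b i)]).prod).unop (p 0) = p m := by
    intro m
    induction m with
    | zero => intro _; simp
    | succ m ih =>
      intro hm
      rw [List.take_add_one, List.getElem?_eq_getElem (by simpa using hm)]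
      have := h ⟨m, hm⟩
      dsimp only at this
      simp only [List.getElem_finRange, Option.toList_some, List.flatMap_append,
        List.flatMap_singleton, List.prod_append, map_mul, MulOpposite.unop_mul,
        RelIso.mul_apply, ih (by omega)]
      simpa using this
  simpa [wordLetters, List.take_of_length_le] using key k le_rfl

/-- Pushing along the mirrored catenation `(J_k, I_k, …, J₁, I₁)`: there are right
actions `σ` of `A` supported on `⋃ Iᵢ` (preserving each `Iᵢ`) and `τ` of `B` supported
on `⋃ Jᵢ` (preserving each `Jᵢ`) such that the induced action `ν` of `A ∗ B` moves the
point `2k = sup J₁` into `(0, ε)` under `w = a₁b₁⋯a_k b_k`, where `0 = inf J_k`. -/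
theorem catenation_push_left
    {A B : Type*} [Group A] [Group B] [Countable A] [Countable B]
    (hA : IsRightOrderable A) (hB : IsRightOrderable B)
    {k : ℕ} (hk : 1 ≤ k) (a : Fin k → A) (b : Fin k → B)
    (ha : ∀ i, a i ≠ 1) (hb : ∀ i, b i ≠ 1) (ε : ℝ) (hε : 0 < ε) :
    ∃ (σ : A → (ℝ ≃o ℝ)) (τ : B → (ℝ ≃o ℝ)) (ν : Monoid.Coprod A B → (ℝ ≃o ℝ)),
      (∀ g h : A, σ (g * h) = (σ g).trans (σ h)) ∧
      (∀ g h : B, τ (g * h) = (τ g).trans (τ h)) ∧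
      (∀ α : A, ∀ i : Fin k, ⇑(σ α) '' mirI k i = mirI k i) ∧
      (∀ α : A, ∀ x : ℝ, x ∉ ⋃ i : Fin k, mirI k (i : ℕ) → σ α x = x) ∧
      (∀ β : B, ∀ i : Fin k, ⇑(τ β) '' mirJ k i = mirJ k i) ∧
      (∀ β : B, ∀ x : ℝ, x ∉ ⋃ i : Fin k, mirJ k (i : ℕ) → τ β x = x) ∧
      IsRightAction ν ∧
      (∀ α : A, ν (Monoid.Coprod.inl α) = σ α) ∧
      (∀ β : B, ν (Monoid.Coprod.inr β) = τ β) ∧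
      ν ((wordLetters a b).prod) (2 * (k : ℝ)) ∈ Set.Ioo (0 : ℝ) ε := by
  let δ : ℝ := min (ε / 2) (1 / 2)
  have hδ : 0 < δ := lt_min (by linarith) (by norm_num)
  have hδ₁ : δ ≤ ε / 2 := min_le_left _ _
  have hδ₂ : δ ≤ 1 / 2 := min_le_right _ _
  let p : ℕ → ℝ := fun i => if i = 0 then 2 * (k : ℝ) else 2 * ((k : ℝ) - i) + δ
  let q : ℕ → ℝ := fun i => 2 * ((k : ℝ) - (i + 1)) + 1 + δ
  have hp : ∀ i, 2 * ((k : ℝ) - i) ≤ p i ∧ p i ≤ 2 * ((k : ℝ) - i) + δ := by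
    intro i
    by_cases hi : i = 0
    · simp [p, hi, hδ.le]
    · simp [p, hi, hδ.le]
  have hp' : ∀ i, p (i + 1) = 2 * ((k : ℝ) - (i + 1)) + δ := by
    intro i
    simp [p]
  let m : Fin k → ℤ := fun i => (k : ℤ) - (i + 1)
  have hm : Function.Injective m := fun i j h => by
    apply Fin.ext
    simp only [m] at h
    omega
  have hmc : ∀ i, (m i : ℝ) = (k : ℝ) - ((i : ℕ) + 1) := by
    intro i
    simp [m]
  obtain ⟨σ, hσI, hσ, hσa⟩ := hA.exists_interval_action 1 hm
    (I := fun i : Fin k => mirI k i) (x := fun i => p i) (y := fun i => q i)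
    (fun i => by
      rw [hmc, mirI, add_assoc _ (1 : ℝ) 2]
      norm_num) ha
    (fun i => by
      have := hp i
      constructor <;> linarith)
    (fun i => by
      constructor <;> simp only [q] <;> linarith)
    (fun i => by
      have := hp i
      simp only [q]
      linarith)
  obtain ⟨τ, hτJ, hτ, hτb⟩ := hB.exists_interval_action 0 hm
    (I := fun i : Fin k => mirJ k i) (x := fun i => q i) (y := fun i => p (i + 1))
    (fun i => by rw [hmc, mirJ, add_zero]) hb
    (fun i => by
      constructor <;> simp only [q] <;> linarith)
    (fun i => by
      rw [hp']
      constructor <;> linarith)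
    (fun i => by
      rw [hp']
      simp only [q]
      linarith)
  refine ⟨fun α => (σ α).unop, fun β => (τ β).unop,
    fun g => (Monoid.Coprod.lift σ τ g).unop, fun g h => ?_, fun g h => ?_, hσI, hσ, hτJ, hτ,
    fun g h => ?_, fun α => ?_, fun β => ?_, ?_⟩
  · exact congrArg MulOpposite.unop (map_mul _ g h)
  · exact congrArg MulOpposite.unop (map_mul _ g h)
  · exact congrArg MulOpposite.unop (map_mul _ g h)
  · simp
  · simp
  · have h := wordLetters_prod_apply a b (Monoid.Coprod.lift σ τ) p fun i => by
      rw [Monoid.Coprod.lift_apply_inl, Monoid.Coprod.lift_apply_inr, hσa, hτb]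
    have hp₀ : p 0 = 2 * (k : ℝ) := if_pos rfl
    have hpk : p k = δ := by
      have : k ≠ 0 := by omega
      simp [p, this]
    rw [← hp₀, h, hpk]
    exact ⟨hδ, by linarith⟩
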